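/- For every k ≥ 0, the Binomial SP graph B_k on 2^k + 1 vertices is a broadcast graph; that is, b(B_k) = ⌈log₂(2^k + 1)⌉ = k + 1. -/

import Mathlib

/-- A broadcast scheme from originator `v`: `A i` is the set of informed vertices
after `i` time units.  At time 0 only `v` is informed, and during each time unit every
informed vertex may inform at most one uninformed neighbor. -/
def IsBroadcastScheme {V : Type*} [DecidableEq V] (G : SimpleGraph V) (v : V)
    (A : ℕ → Finset V) : Prop :=
  A 0 = {v} ∧
  ∀ i : ℕ, A i ⊆ A (i + 1) ∧
    ∃ f : V → V,
      (∀ w ∈ A (i + 1) \ A i, f w ∈ A i ∧ G.Adj (f w) w) ∧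
      Set.InjOn f ↑(A (i + 1) \ A i)

/-- `b(v, G)`: the minimum number of time units needed to inform all vertices from `v`. -/
noncomputable def broadcastTimeFrom {V : Type*} [DecidableEq V] [Fintype V]
    (G : SimpleGraph V) (v : V) : ℕ :=
  sInf {T | ∃ A : ℕ → Finset V, IsBroadcastScheme G v A ∧ A T = Finset.univ}

/-- `b(G)`: the maximum over all originators `v` of `b(v, G)`. -/
noncomputable def broadcastTime {V : Type*} [DecidableEq V] [Fintype V]
    (G : SimpleGraph V) : ℕ :=
  Finset.univ.sup fun v => broadcastTimeFrom G v

/-- The parent of `j ≠ 0` in the binomial tree encoding: clear the highest set bit. -/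
def btParent (j : ℕ) : ℕ := j - 2 ^ Nat.log 2 j

/-- The Binomial SP graph `B k` on `2^k + 1` vertices: a binomial tree `BT k` rooted at
`s = some 0` (vertex `some j`, `j ≠ 0`, is joined to its parent obtained by clearing the
highest set bit of `j`), together with an additional vertex `t = none` adjacent to all
`2^k` tree vertices. -/
def Bgraph (k : ℕ) : SimpleGraph (Option (Fin (2 ^ k))) :=
  SimpleGraph.fromRel fun a b =>
    match a, b with
    | some i, some j => (j : ℕ) ≠ 0 ∧ (i : ℕ) = btParent (j : ℕ)
    | none, some _ => True
    | _, _ => False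

theorem IsBroadcastScheme.card_le {V : Type*} [DecidableEq V] {G : SimpleGraph V} {v : V}
    {A : ℕ → Finset V} (h : IsBroadcastScheme G v A) (T : ℕ) : (A T).card ≤ 2 ^ T := by
  induction T with
  | zero => simp [h.1]
  | succ i ih =>
    obtain ⟨hsub, f, hf, hinj⟩ := h.2 i
    have h1 : (A (i + 1) \ A i).card ≤ (A i).card :=
      Finset.card_le_card_of_injOn f (fun w hw => (hf w hw).1) hinj
    have h2 := Finset.card_sdiff_add_card_eq_card hsub
    rw [pow_succ]
    omega

theorem Bgraph_adj_none_some (k : ℕ) (i : Fin (2 ^ k)) : (Bgraph k).Adj none (some i) := by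
  simp [Bgraph]

theorem btParent_eq_sub {j T : ℕ} (h₁ : 2 ^ T ≤ j) (h₂ : j < 2 ^ (T + 1)) :
    btParent j = j - 2 ^ T := by
  rw [btParent, (Nat.log_eq_iff (Or.inr ⟨by norm_num, by have := Nat.two_pow_pos T; omega⟩)).2
    ⟨h₁, h₂⟩]

theorem Bgraph_adj_some_some {k T : ℕ} {i j : Fin (2 ^ k)} (h₁ : 2 ^ T ≤ (j : ℕ))
    (h₂ : (j : ℕ) < 2 ^ (T + 1)) (hi : (i : ℕ) = j - 2 ^ T) :
    (Bgraph k).Adj (some i) (some j) := by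
  have hpos := Nat.two_pow_pos T
  rw [Bgraph, SimpleGraph.fromRel_adj]
  refine ⟨fun h => ?_, Or.inl ⟨by omega, by rw [btParent_eq_sub h₁ h₂, hi]⟩⟩
  have := congrArg Fin.val (Option.some.inj h)
  omega

theorem exists_broadcastScheme_none (k : ℕ) :
    ∃ A : ℕ → Finset (Option (Fin (2 ^ k))),
      IsBroadcastScheme (Bgraph k) none A ∧ A (k + 1) = Finset.univ := by
  let A : ℕ → Finset (Option (Fin (2 ^ k))) := fun n => match n with
    | 0 => {none}
    | T + 1 => Finset.univ.filter fun x => ∀ j, x = some j → (j : ℕ) < 2 ^ T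
  have mem_none (T : ℕ) : none ∈ A (T + 1) := by simp [A]
  have mem_some (T : ℕ) (j : Fin (2 ^ k)) : some j ∈ A (T + 1) ↔ (j : ℕ) < 2 ^ T := by simp [A]
  refine ⟨A, ⟨rfl, ?_⟩, ?_⟩
  · rintro (_ | T)
    · refine ⟨by simp [A], fun _ => none, ?_, ?_⟩
      · rintro (_ | w) hw
        · simp [A] at hw
        · exact ⟨by simp [A], Bgraph_adj_none_some k w⟩
      · rintro (_ | a) ha (_ | b) hb -
        · rfl
        · simp [A] at ha
        · simp [A] at hb
        · have ha' := (mem_some 0 a).1 (Finset.mem_sdiff.1 ha).1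
          have hb' := (mem_some 0 b).1 (Finset.mem_sdiff.1 hb).1
          congr 1
          ext
          omega
    · have key : ∀ w ∈ A (T + 1 + 1) \ A (T + 1), ∃ j : Fin (2 ^ k), w = some j ∧
          2 ^ T ≤ (j : ℕ) ∧ (j : ℕ) < 2 ^ (T + 1) := by
        rintro (_ | j) hj
        · exact absurd (mem_none T) (Finset.mem_sdiff.1 hj).2
        · rw [Finset.mem_sdiff, mem_some, mem_some] at hj
          exact ⟨j, rfl, by omega, hj.1⟩
      refine ⟨?_, Option.map fun j => ⟨j - 2 ^ T, (Nat.sub_le _ _).trans_lt j.isLt⟩, ?_, ?_⟩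
      · rintro (_ | j) hj
        · exact mem_none _
        · rw [mem_some] at hj ⊢
          rw [pow_succ]
          omega
      · intro w hw
        obtain ⟨j, rfl, h₁, h₂⟩ := key w hw
        refine ⟨(mem_some _ _).2 ?_, Bgraph_adj_some_some h₁ h₂ rfl⟩
        rw [pow_succ] at h₂
        show (j : ℕ) - 2 ^ T < 2 ^ T
        omega
      · intro a ha b hb hab
        obtain ⟨i, rfl, hi, -⟩ := key a ha
        obtain ⟨j, rfl, hj, -⟩ := key b hb
        simp only [Option.map_some, Option.some.injEq, Fin.mk.injEq] at hab
        congr 1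
        ext
        omega
  · ext (_ | j)
    · simpa using mem_none k
    · simp [mem_some]

theorem mod_two_pow_succ_cases (v T : ℕ) :
    v % 2 ^ (T + 1) = v % 2 ^ T ∨ v % 2 ^ (T + 1) = v % 2 ^ T + 2 ^ T := by
  rw [Nat.mod_pow_succ]
  rcases Nat.mod_two_eq_zero_or_one (v / 2 ^ T) with h | h <;> simp [h]

/-- From a tree vertex `v`, first inform the apex; after `T + 1` time units the informed tree
vertices are `v` and all `j < 2 ^ T` other than `v % 2 ^ T`. -/
theorem exists_broadcastScheme_some (k : ℕ) (v : Fin (2 ^ k)) :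
    ∃ A : ℕ → Finset (Option (Fin (2 ^ k))),
      IsBroadcastScheme (Bgraph k) (some v) A ∧ A (k + 1) = Finset.univ := by
  let A : ℕ → Finset (Option (Fin (2 ^ k))) := fun n => match n with
    | 0 => {some v}
    | T + 1 => Finset.univ.filter fun x =>
        ∀ j, x = some j → j = v ∨ ((j : ℕ) < 2 ^ T ∧ (j : ℕ) ≠ v % 2 ^ T)
  have mem_none (T : ℕ) : none ∈ A (T + 1) := by simp [A]
  have mem_some (T : ℕ) (j : Fin (2 ^ k)) : some j ∈ A (T + 1) ↔
      (j : ℕ) = v ∨ ((j : ℕ) < 2 ^ T ∧ (j : ℕ) ≠ v % 2 ^ T) := by simp [A, Fin.val_inj]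
  refine ⟨A, ⟨rfl, ?_⟩, ?_⟩
  · rintro (_ | T)
    · have key : ∀ w ∈ A (0 + 1) \ A 0, w = none := by
        rintro (_ | w) hw
        · rfl
        · have h₁ := (mem_some 0 w).1 (Finset.mem_sdiff.1 hw).1
          have h₂ : ¬ w = v := by simpa [A] using (Finset.mem_sdiff.1 hw).2
          rw [Fin.ext_iff] at h₂
          rw [pow_zero, Nat.mod_one] at h₁
          omega
      refine ⟨by simp [A], fun _ => some v, ?_, ?_⟩
      · intro w hw
        rw [key w hw]
        exact ⟨by simp [A], (Bgraph_adj_none_some k v).symm⟩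
      · intro a ha b hb _
        rw [key a ha, key b hb]
    · have hpos := Nat.two_pow_pos T
      have hlt := Nat.mod_lt (v : ℕ) hpos
      have hle := Nat.mod_le (v : ℕ) (2 ^ T)
      have hcases := mod_two_pow_succ_cases v T
      have hpow : 2 ^ (T + 1) = 2 ^ T * 2 := pow_succ 2 T
      have key : ∀ w ∈ A (T + 1 + 1) \ A (T + 1), ∃ j : Fin (2 ^ k), w = some j ∧
          (j : ℕ) < 2 ^ (T + 1) ∧ (j : ℕ) ≠ v % 2 ^ (T + 1) ∧
            (2 ^ T ≤ (j : ℕ) ∨ (j : ℕ) = v % 2 ^ T) := by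
        rintro (_ | j) hj
        · exact absurd (mem_none T) (Finset.mem_sdiff.1 hj).2
        · rw [Finset.mem_sdiff, mem_some, mem_some] at hj
          exact ⟨j, rfl, by omega, by omega, by omega⟩
      let f : Option (Fin (2 ^ k)) → Option (Fin (2 ^ k)) := fun x => x.bind fun j =>
        if 2 ^ T ≤ (j : ℕ) ∧ (j : ℕ) - 2 ^ T ≠ v % 2 ^ T then
          some ⟨j - 2 ^ T, by omega⟩ else none
      refine ⟨?_, f, ?_, ?_⟩
      · rintro (_ | j) hj
        · exact mem_none _
        · rw [mem_some] at hj ⊢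
          omega
      · intro w hw
        obtain ⟨j, rfl, h₁, h₂, h₃⟩ := key w hw
        by_cases hc : 2 ^ T ≤ (j : ℕ) ∧ (j : ℕ) - 2 ^ T ≠ v % 2 ^ T
        · simp only [f, Option.bind_some, if_pos hc]
          refine ⟨(mem_some _ _).2 (Or.inr ⟨?_, hc.2⟩), Bgraph_adj_some_some hc.1 h₁ rfl⟩
          show (j : ℕ) - 2 ^ T < 2 ^ T
          omega
        · simp only [f, Option.bind_some, if_neg hc]
          exact ⟨mem_none T, Bgraph_adj_none_some k j⟩
      · intro a ha b hb hab
        obtain ⟨i, rfl, hi₁, hi₂, hi₃⟩ := key a ha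
        obtain ⟨j, rfl, hj₁, hj₂, hj₃⟩ := key b hb
        simp only [f, Option.bind_some] at hab
        congr 1
        ext
        split_ifs at hab with h₁ h₂
        · simp only [Option.some.injEq, Fin.mk.injEq] at hab
          omega
        · omega
  · ext (_ | j)
    · simpa using mem_none k
    · simp only [mem_some, Finset.mem_univ, iff_true, Nat.mod_eq_of_lt v.isLt]
      have := j.isLt
      tauto

theorem exists_broadcastScheme (k : ℕ) (v : Option (Fin (2 ^ k))) :
    ∃ A : ℕ → Finset (Option (Fin (2 ^ k))),
      IsBroadcastScheme (Bgraph k) v A ∧ A (k + 1) = Finset.univ := by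
  cases v with
  | none => exact exists_broadcastScheme_none k
  | some v => exact exists_broadcastScheme_some k v

theorem broadcastTimeFrom_Bgraph (k : ℕ) (v : Option (Fin (2 ^ k))) :
    broadcastTimeFrom (Bgraph k) v = k + 1 := by
  refine le_antisymm (Nat.sInf_le (exists_broadcastScheme k v)) ?_
  refine le_csInf ⟨_, exists_broadcastScheme k v⟩ ?_
  rintro T ⟨A, hA, hT⟩
  have h := hA.card_le T
  rw [hT, Finset.card_univ, Fintype.card_option, Fintype.card_fin] at h
  exact (Nat.pow_lt_pow_iff_right (by norm_num)).1 h

/-- For every `k ≥ 0`, the Binomial SP graph `B k` on `2^k + 1` vertices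
is a broadcast graph: `b(B k) = ⌈log₂ (2^k + 1)⌉ = k + 1`. -/
theorem broadcastTime_Bgraph (k : ℕ) :
    broadcastTime (Bgraph k) = k + 1 ∧ Nat.clog 2 (2 ^ k + 1) = k + 1 := by
  constructor
  · simp only [broadcastTime, broadcastTimeFrom_Bgraph]
    exact Finset.sup_const Finset.univ_nonempty _
  · refine le_antisymm (Nat.clog_le_of_le_pow ?_) ?_
    · rw [pow_succ]
      have := Nat.two_pow_pos k
      omega
    · exact (Nat.lt_clog_iff_pow_lt (by norm_num)).2 (Nat.lt_succ_self _)
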